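/- arXiv:1301.3188 — 2 statements merged into one kernel-verified Lean document; each statement's English description precedes it below -/
import Mathlib

section
/- If π ∈ 𝒜 is a simple permutation of length n ≥ 4 with π(1) > π(n), then the position of its minimum precedes the position of its maximum: π⁻¹(1) < π⁻¹(n) (i.e., its extreme pattern is 3142, not 3412). -/
/-- `σ` is contained in `π` as a pattern. -/
def Contains {k n : ℕ} (σ : Equiv.Perm (Fin k)) (π : Equiv.Perm (Fin n)) : Prop :=
  ∃ f : Fin k → Fin n, StrictMono f ∧ ∀ i j : Fin k, σ i < σ j ↔ π (f i) < π (f j)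

/-- `π` avoids the pattern `σ`. -/
def Avoids {k n : ℕ} (σ : Equiv.Perm (Fin k)) (π : Equiv.Perm (Fin n)) : Prop :=
  ¬ Contains σ π

/-- The permutation 4231 (0-indexed values). -/
noncomputable def p4231 : Equiv.Perm (Fin 4) := Equiv.ofBijective ![3,1,2,0] (by decide)

/-- The permutation 35142 (0-indexed values). -/
noncomputable def p35142 : Equiv.Perm (Fin 5) := Equiv.ofBijective ![2,4,0,3,1] (by decide)

/-- The permutation 42513 (0-indexed values). -/
noncomputable def p42513 : Equiv.Perm (Fin 5) := Equiv.ofBijective ![3,1,4,0,2] (by decide)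

/-- The permutation 351624 (0-indexed values). -/
noncomputable def p351624 : Equiv.Perm (Fin 6) := Equiv.ofBijective ![2,4,0,5,1,3] (by decide)

/-- Membership in the class 𝒜 = Av(4231, 35142, 42513, 351624). -/
def InA {n : ℕ} (π : Equiv.Perm (Fin n)) : Prop :=
  Avoids p4231 π ∧ Avoids p35142 π ∧ Avoids p42513 π ∧ Avoids p351624 π

/-- `s` is an interval of `π`: a set of consecutive positions whose image
under `π` is a set of consecutive values. -/
def IsPermInterval {n : ℕ} (π : Equiv.Perm (Fin n)) (s : Finset (Fin n)) : Prop :=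
  (∀ a ∈ s, ∀ b ∈ s, ∀ j : Fin n, a ≤ j → j ≤ b → j ∈ s) ∧
  (∀ a ∈ s, ∀ b ∈ s, ∀ j : Fin n, π a ≤ π j → π j ≤ π b → j ∈ s)

/-- `π` is simple: its only intervals are singletons (or empty) and the whole domain. -/
def IsSimple {n : ℕ} (π : Equiv.Perm (Fin n)) : Prop :=
  ∀ s : Finset (Fin n), IsPermInterval π s → s.card ≤ 1 ∨ s = Finset.univ

/-- The reverse complement of a permutation. -/
def revComp {n : ℕ} (π : Equiv.Perm (Fin n)) : Equiv.Perm (Fin n) :=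
  (Fin.revPerm.trans π).trans Fin.revPerm

/-- The skew sum `σ ⊖ τ`. -/
def skewSum {m k : ℕ} (σ : Equiv.Perm (Fin m)) (τ : Equiv.Perm (Fin k)) :
    Equiv.Perm (Fin (m + k)) :=
  finSumFinEquiv.symm.trans ((Equiv.sumCongr σ τ).trans
    ((Equiv.sumComm (Fin m) (Fin k)).trans (finSumFinEquiv.trans (finCongr (Nat.add_comm k m)))))

/-- The direct sum `α ⊕ β`. -/
def directSum {m k : ℕ} (α : Equiv.Perm (Fin m)) (β : Equiv.Perm (Fin k)) :
    Equiv.Perm (Fin (m + k)) :=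
  finSumFinEquiv.symm.trans ((Equiv.sumCongr α β).trans finSumFinEquiv)

/-- The permutation 312 (0-indexed values). -/
noncomputable def p312 : Equiv.Perm (Fin 3) := Equiv.ofBijective ![2,0,1] (by decide)

/-- The permutation 231 (0-indexed values). -/
noncomputable def p231 : Equiv.Perm (Fin 3) := Equiv.ofBijective ![1,2,0] (by decide)

/-- The number of simple permutations of length `n` in the class 𝒜. -/
noncomputable def simpleCount (n : ℕ) : ℕ :=
  Nat.card {π : Equiv.Perm (Fin n) // IsSimple π ∧ InA π}

theorem contains_p4231 {n : ℕ} {π : Equiv.Perm (Fin n)} {a b c d : Fin n}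
    (hab : a < b) (hbc : b < c) (hcd : c < d)
    (hdb : π d < π b) (hbc' : π b < π c) (hca : π c < π a) : Contains p4231 π := by
  refine ⟨![a, b, c, d], Fin.strictMono_iff_lt_succ.2 ?_, ?_⟩
  · intro i
    fin_cases i <;> simp <;> assumption
  · intro i j
    fin_cases i <;> fin_cases j <;> simp [p4231] <;> order

theorem contains_p35142 {n : ℕ} {π : Equiv.Perm (Fin n)} {a b c d e : Fin n}
    (hab : a < b) (hbc : b < c) (hcd : c < d) (hde : d < e)
    (hce : π c < π e) (hea : π e < π a) (had : π a < π d) (hdb : π d < π b) :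
    Contains p35142 π := by
  refine ⟨![a, b, c, d, e], Fin.strictMono_iff_lt_succ.2 ?_, ?_⟩
  · intro i
    fin_cases i <;> simp <;> assumption
  · intro i j
    fin_cases i <;> fin_cases j <;> simp [p35142] <;> order

theorem contains_p42513 {n : ℕ} {π : Equiv.Perm (Fin n)} {a b c d e : Fin n}
    (hab : a < b) (hbc : b < c) (hcd : c < d) (hde : d < e)
    (hdb : π d < π b) (hbe : π b < π e) (hea : π e < π a) (hac : π a < π c) :
    Contains p42513 π := by
  refine ⟨![a, b, c, d, e], Fin.strictMono_iff_lt_succ.2 ?_, ?_⟩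
  · intro i
    fin_cases i <;> simp <;> assumption
  · intro i j
    fin_cases i <;> fin_cases j <;> simp [p42513] <;> order

/-- A simple permutation of length at least three is not a skew sum: there is no proper nonempty
set of positions all of which lie to the left of and above the remaining ones. -/
theorem IsSimple.not_skew_decomposable {n : ℕ} (hn : 3 ≤ n) {π : Equiv.Perm (Fin n)}
    (hπ : IsSimple π) (s : Finset (Fin n)) {p q : Fin n} (hp : p ∈ s) (hq : q ∉ s) :
    ¬ ∀ i ∈ s, ∀ j ∉ s, i < j ∧ π j < π i := by
  intro hs
  have hs_int : IsPermInterval π s := by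
    refine ⟨fun a _ b hb j _ hjb => ?_, fun a ha b _ j haj _ => ?_⟩
    · by_contra hj
      exact absurd (hs b hb j hj).1 hjb.not_gt
    · by_contra hj
      exact absurd (hs a ha j hj).2 haj.not_gt
  have hsc_int : IsPermInterval π sᶜ := by
    refine ⟨fun a ha b _ j haj _ => ?_, fun a _ b hb j _ hjb => ?_⟩
    · by_contra hj
      exact absurd (hs j (by simpa using hj) a (by simpa using ha)).1 haj.not_gt
    · by_contra hj
      exact absurd (hs j (by simpa using hj) b (by simpa using hb)).2 hjb.not_gt
  have h1 : s.card ≤ 1 := (hπ s hs_int).resolve_right fun h => hq (h ▸ Finset.mem_univ q)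
  have h2 : sᶜ.card ≤ 1 := (hπ sᶜ hsc_int).resolve_right fun h =>
    Finset.mem_compl.1 (h ▸ Finset.mem_univ p : p ∈ sᶜ) hp
  have h3 := Finset.card_add_card_compl s
  rw [Fintype.card_fin] at h3
  omega

/-- If the maximum precedes the minimum and the first value exceeds the last, then every entry
before the maximum exceeds every entry after the minimum. -/
theorem InA.lt_of_lt_max_of_min_lt {n : ℕ} {π : Equiv.Perm (Fin n)} (hA : InA π)
    {l r p q : Fin n} (hl : ∀ i, l ≤ i) (hr : ∀ i, i ≤ r) (hlr : π r < π l)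
    (hmax : ∀ i, π i ≤ π p) (hmin : ∀ i, π q ≤ π i) (hpq : p < q)
    {x z : Fin n} (hx : x < p) (hz : q < z) : π z < π x := by
  obtain ⟨hA₁, hA₂, hA₃, -⟩ := hA
  have hmax' : ∀ i, i ≠ p → π i < π p := fun i hi =>
    lt_of_le_of_ne (hmax i) (π.injective.ne hi)
  have hmin' : ∀ i, i ≠ q → π q < π i := fun i hi =>
    lt_of_le_of_ne (hmin i) (π.injective.ne hi.symm)
  have hlp : l < p := (hl x).trans_lt hx
  have hqr : q < r := hz.trans_le (hr z)
  have hzl : π z < π l := by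
    by_contra! hc
    have hne : π l ≠ π z := π.injective.ne (by order)
    have hzr : z < r := lt_of_le_of_ne (hr z) (by rintro rfl; order)
    exact hA₂ (contains_p35142 hlp hpq hz hzr (hmin' r hqr.ne') hlr
      (lt_of_le_of_ne hc hne) (hmax' z (by order)))
  have hrx : π r < π x := by
    by_contra! hc
    have hne : π x ≠ π r := π.injective.ne (by order)
    have hlx : l < x := lt_of_le_of_ne (hl x) (by rintro rfl; order)
    exact hA₃ (contains_p42513 hlx hx hpq hqr (hmin' x (by order))
      (lt_of_le_of_ne hc hne) hlr (hmax' l hlp.ne))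
  by_contra! hc
  have hne : π x ≠ π z := π.injective.ne (by order)
  have hlx : l < x := lt_of_le_of_ne (hl x) (by rintro rfl; order)
  have hzr : z < r := lt_of_le_of_ne (hr z) (by rintro rfl; order)
  exact hA₁ (contains_p4231 hlx (by order) hzr hrx (lt_of_le_of_ne hc hne) hzl)

theorem statement_8 {n : ℕ} (hn : 4 ≤ n) (π : Equiv.Perm (Fin n))
    (hsimple : IsSimple π) (hA : InA π) (h : π ⟨n - 1, by omega⟩ < π ⟨0, by omega⟩) :
    π⁻¹ ⟨0, by omega⟩ < π⁻¹ ⟨n - 1, by omega⟩ := by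
  set q := π⁻¹ ⟨0, by omega⟩ with hq
  set p := π⁻¹ ⟨n - 1, by omega⟩ with hp
  have hπq : π q = ⟨0, by omega⟩ := by simp [hq]
  have hπp : π p = ⟨n - 1, by omega⟩ := by simp [hp]
  have hmax : ∀ i, π i ≤ π p := fun i => by
    rw [hπp, Fin.le_def]
    have := (π i).isLt
    simp only
    omega
  have hmin : ∀ i, π q ≤ π i := fun i => by
    rw [hπq, Fin.le_def]
    simp
  by_contra! hle
  have hpq : p < q := lt_of_le_of_ne hle fun he => by
    rw [he, hπq, Fin.mk.injEq] at hπp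
    omega
  have hcross : ∀ x z, x < p → q < z → π z < π x := fun x z hx hz =>
    hA.lt_of_lt_max_of_min_lt (l := ⟨0, by omega⟩) (r := ⟨n - 1, by omega⟩)
      (fun i => by simp [Fin.le_def]) (fun i => by rw [Fin.le_def]; simp only; omega)
      h hmax hmin hpq hx hz
  have hdecr : ∀ x y, p < x → x < y → y < q → π y < π x := fun x y hx hxy hy => by
    by_contra! hc
    have hxy' : π x ≠ π y := π.injective.ne hxy.ne
    have hqx : π q ≠ π x := π.injective.ne (by order)
    have hyp : π y ≠ π p := π.injective.ne (by order)
    exact hA.1 (contains_p4231 hx hxy hy (lt_of_le_of_ne (hmin x) hqx)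
      (lt_of_le_of_ne hc hxy') (lt_of_le_of_ne (hmax y) hyp))
  classical
  let s : Finset (Fin n) := Finset.univ.filter fun i =>
    i ≤ p ∨ ∃ y, i ≤ y ∧ p < y ∧ y < q ∧ ∃ x < p, π x < π y
  have hs : ∀ i, i ∈ s ↔ i ≤ p ∨ ∃ y, i ≤ y ∧ p < y ∧ y < q ∧ ∃ x < p, π x < π y := by
    simp [s]
  refine hsimple.not_skew_decomposable (by omega) s (p := p) (q := q) ((hs p).2 (.inl le_rfl))
    (fun hqs => ?_) fun i hi j hj => ?_
  · rcases (hs q).1 hqs with h₁ | ⟨y, h₁, -, h₂, -⟩ <;> order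
  rw [hs, not_or] at hj
  obtain ⟨hpj, hj⟩ := hj
  rw [not_le] at hpj
  have hij : i < j := by
    rcases (hs i).1 hi with hip | ⟨y, hiy, hy⟩
    · order
    · by_contra! hji
      exact hj ⟨y, hji.trans hiy, hy⟩
  refine ⟨hij, lt_of_le_of_ne ?_ (π.injective.ne hij.ne')⟩
  by_cases hip : i = p
  · exact hip ▸ hmax j
  rcases lt_trichotomy j q with hjq | rfl | hqj
  · rcases lt_or_ge p i with hpi | hpi
    · exact (hdecr i j hpi hij hjq).le
    · by_contra! hc
      exact hj ⟨j, le_rfl, hpj, hjq, i, lt_of_le_of_ne hpi hip, hc⟩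
  · exact hmin i
  · rcases (hs i).1 hi with hpi | ⟨y, hiy, hpy, hyq, x, hxp, hxy⟩
    · exact (hcross i j (lt_of_le_of_ne hpi hip) hqj).le
    · have hjx := hcross x j hxp hqj
      rcases lt_or_ge p i with hpi | hpi
      · rcases hiy.eq_or_lt with rfl | hiy
        · order
        · have := hdecr i y hpi hiy hyq
          order
      · exact (hcross i j (lt_of_le_of_ne hpi hip) hqj).le
end

section
/- Every simple permutation π ∈ 𝒜 of length n ≥ 4 satisfies exactly one of the following: its leftmost entry is 2 (π(1) = 2), or its second entry is 1 (π(2) = 1). -/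
section PatternOccurrences

variable {n : ℕ} {π : Equiv.Perm (Fin n)}

lemma Avoids.not_4231 (h : Avoids p4231 π) {a b c d : Fin n} (hab : a < b) (hbc : b < c)
    (hcd : c < d) (hdb : π d < π b) (hbc' : π b < π c) (hca : π c < π a) : False := by
  refine h ⟨![a, b, c, d], ?_, ?_⟩
  · rw [Fin.strictMono_iff_lt_succ]
    intro i
    fin_cases i <;> assumption
  · intro i j
    fin_cases i <;> fin_cases j <;> simp [p4231] <;> order

lemma Avoids.not_35142 (h : Avoids p35142 π) {a b c d e : Fin n} (hab : a < b) (hbc : b < c)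
    (hcd : c < d) (hde : d < e) (hce : π c < π e) (hea : π e < π a) (had : π a < π d)
    (hdb : π d < π b) : False := by
  refine h ⟨![a, b, c, d, e], ?_, ?_⟩
  · rw [Fin.strictMono_iff_lt_succ]
    intro i
    fin_cases i <;> assumption
  · intro i j
    fin_cases i <;> fin_cases j <;> simp [p35142] <;> order

lemma Avoids.not_42513 (h : Avoids p42513 π) {a b c d e : Fin n} (hab : a < b) (hbc : b < c)
    (hcd : c < d) (hde : d < e) (hdb : π d < π b) (hbe : π b < π e) (hea : π e < π a)
    (hac : π a < π c) : False := by
  refine h ⟨![a, b, c, d, e], ?_, ?_⟩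
  · rw [Fin.strictMono_iff_lt_succ]
    intro i
    fin_cases i <;> assumption
  · intro i j
    fin_cases i <;> fin_cases j <;> simp [p42513] <;> order

lemma Avoids.not_351624 (h : Avoids p351624 π) {a b c d e f : Fin n} (hab : a < b) (hbc : b < c)
    (hcd : c < d) (hde : d < e) (hef : e < f) (hce : π c < π e) (hea : π e < π a)
    (haf : π a < π f) (hfb : π f < π b) (hbd : π b < π d) : False := by
  refine h ⟨![a, b, c, d, e, f], ?_, ?_⟩
  · rw [Fin.strictMono_iff_lt_succ]
    intro i
    fin_cases i <;> assumption
  · intro i j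
    fin_cases i <;> fin_cases j <;> simp [p351624] <;> order

end PatternOccurrences

/-- A simple permutation has no interval that contains two distinct positions and misses a third. -/
lemma IsSimple.not_interval {n : ℕ} {π : Equiv.Perm (Fin n)} (h : IsSimple π) (P : Fin n → Prop)
    {x y z : Fin n} (hx : P x) (hy : P y) (hxy : x ≠ y) (hz : ¬ P z)
    (hpos : ∀ a b j, P a → P b → a ≤ j → j ≤ b → P j)
    (hval : ∀ a b j, P a → P b → π a ≤ π j → π j ≤ π b → P j) : False := by
  classical
  rcases h (Finset.univ.filter P) ⟨by simpa using fun a ha b hb j => hpos a b j ha hb,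
    by simpa using fun a ha b hb j => hval a b j ha hb⟩ with h1 | h1
  · exact hxy (Finset.card_le_one.mp h1 x (by simpa using hx) y (by simpa using hy))
  · exact hz (Finset.mem_filter.mp (h1.symm ▸ Finset.mem_univ z)).2

lemma exists_max_of_pred {n : ℕ} (P : Fin n → Prop) (f : Fin n → Fin n) (h : ∃ x, P x) :
    ∃ m, P m ∧ ∀ y, P y → f y ≤ f m := by
  classical
  obtain ⟨x, hx⟩ := h
  obtain ⟨m, hm, hmax⟩ := (Finset.univ.filter P).exists_max_image f ⟨x, by simpa using hx⟩
  exact ⟨m, by simpa using hm, by simpa using hmax⟩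

lemma lt_of_leftmost {n : ℕ} {π : Equiv.Perm (Fin n)} {z x : Fin n} (hz : ∀ j, z ≤ j)
    (h : π x ≠ π z) : z < x :=
  lt_of_le_of_ne (hz x) (by rintro rfl; exact h rfl)

lemma lt_of_least {n : ℕ} {π : Equiv.Perm (Fin n)} {p x : Fin n} (hp : ∀ j, π p ≤ π j)
    (h : x ≠ p) : π p < π x :=
  lt_of_le_of_ne (hp x) fun h' => h (π.injective h').symm

section LeftmostAndLeast

variable {n : ℕ} {π : Equiv.Perm (Fin n)} {z p : Fin n}

/-- No entry of a simple permutation in `𝒜` can be smaller than the leftmost entry and left of the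
least one, if no entry is smaller than the leftmost and right of the least. -/
lemma not_corner_of_no_lower (hsimple : IsSimple π) (hA : InA π)
    (hz : ∀ j, z ≤ j) (hp : ∀ j, π p ≤ π j)
    (hD : ∀ j, p < j → π z < π j) {r : Fin n} (hrp : r < p) (hrz : π r < π z) : False := by
  have inj : ∀ a b, π a = π b → a = b := fun a b h => π.injective h
  have h1 := fun a b c d => @Avoids.not_4231 n π hA.1 a b c d
  have h3 := fun a b c d e => @Avoids.not_42513 n π hA.2.2.1 a b c d e
  obtain ⟨s, ⟨hsp, hsz⟩, hs⟩ :=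
    exists_max_of_pred (fun x => x < p ∧ π x < π z) π ⟨r, hrp, hrz⟩
  clear hrp hrz r
  have hzs : z < s := lt_of_leftmost hz hsz.ne
  have hps : π p < π s := lt_of_least hp hsp.ne
  have hbefore : ∀ x, x < s → π z ≤ π x := by
    intro x hx
    by_contra! hc
    have := hs x ⟨by order, hc⟩
    have hxs : π x ≠ π s := fun h => hx.ne (π.injective h)
    exact h1 z x s p (lt_of_leftmost hz hc.ne) hx hsp (lt_of_least hp (by order)) (by order) hsz
  by_cases hu : ∃ x, z < x ∧ x < s
  · obtain ⟨x, hzx, hxs⟩ := hu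
    by_cases hv : ∃ v, s < v ∧ v < p ∧ π z < π v
    · obtain ⟨v, hsv, hvp, hzv⟩ := hv
      refine hsimple.not_interval (fun i => i < s) hzs hxs hzx.ne (lt_irrefl s)
        (fun a b j ha hb haj hjb => by order) (fun a b j ha hb haj hjb => ?_)
      by_contra! hc
      have h5 := hbefore a ha
      have h6 := hbefore b hb
      have h7 : s ≠ j := by rintro rfl; order
      have h8 : π j ≠ π b := fun h => by have := inj _ _ h; order
      rcases lt_trichotomy j p with h | h | h
      · exact h1 b s j p hb (by order) h hps (by order) (by order)
      · subst h; have := hp z; order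
      · rcases lt_or_ge (π v) (π b) with h9 | h9
        · exact h1 b s v p hb hsv hvp hps (by order) h9
        · have : π b ≠ π v := fun h => by have := inj _ _ h; order
          exact h3 b s v p j hb hsv hvp h hps (by order) (by order) (by order)
    · push Not at hv
      refine hsimple.not_interval (fun i => π i < π z) hsz (by order : π p < π z) hsp.ne
        (lt_irrefl (π z)) (fun a b j ha hb haj hjb => ?_) (fun a b j ha hb haj hjb => by order)
      have h5 : s ≤ a := by
        by_contra! hc
        have := hbefore a hc
        order
      have h6 : b ≤ p := by
        by_contra! hc
        have := hD b hc
        order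
      by_contra! hc
      have : j ≠ p := by rintro rfl; order
      have : j ≠ s := by rintro rfl; order
      have h7 := hv j (by order) (by order)
      have := inj j z (by order)
      order
  · push Not at hu
    refine hsimple.not_interval (fun i => i = z ∨ i = s) (Or.inl rfl) (Or.inr rfl) hzs.ne
      (z := p) (by rintro (rfl | rfl) <;> order) (fun a b j ha hb haj hjb => ?_)
      (fun a b j ha hb haj hjb => ?_)
    · by_contra! hc
      have h5 := hu j (lt_of_le_of_ne (hz j) hc.1.symm)
      rcases hb with rfl | rfl
      · exact hc.1 (le_antisymm hjb (hz j))
      · exact hc.2 (le_antisymm hjb h5)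
    · have h5 : π s ≤ π j := by rcases ha with rfl | rfl <;> rcases hb with rfl | rfl <;> order
      have h6 : π j ≤ π z := by rcases ha with rfl | rfl <;> rcases hb with rfl | rfl <;> order
      by_contra! hc
      have h7 : π j < π z := lt_of_le_of_ne h6 fun h => hc.1 (inj _ _ h)
      have h8 : j < p := by
        rcases lt_trichotomy j p with h | h | h
        · exact h
        · subst h; order
        · have := hD j h; order
      exact hc.2 (inj _ _ (le_antisymm (hs j ⟨h8, h7⟩) h5))

/-- No entry of a simple permutation in `𝒜` can be smaller than the leftmost entry and left of the
least one, if no entry is larger than the leftmost and left of the least. -/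
lemma not_corner_of_no_upper (hsimple : IsSimple π) (hA : InA π)
    (hz : ∀ j, z ≤ j) (hp : ∀ j, π p ≤ π j)
    (hU : ∀ j, j < p → π j ≤ π z) {r : Fin n} (hrp : r < p) (hrz : π r < π z) : False := by
  have inj : ∀ a b, π a = π b → a = b := fun a b h => π.injective h
  have h1 := fun a b c d => @Avoids.not_4231 n π hA.1 a b c d
  have h3 := fun a b c d e => @Avoids.not_42513 n π hA.2.2.1 a b c d e
  obtain ⟨s, ⟨hsp, hsz⟩, hs⟩ :=
    exists_max_of_pred (fun x => x < p ∧ π x < π z) id ⟨r, hrp, hrz⟩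
  simp only [id] at hs
  clear hrp hrz r
  have hzs : z < s := lt_of_leftmost hz hsz.ne
  have hps : π p < π s := lt_of_least hp hsp.ne
  have hbelow : ∀ x, π x < π s → p ≤ x := by
    intro x hx
    by_contra! hc
    have := hs x ⟨hc, by order⟩
    have hxs : x ≠ s := by rintro rfl; order
    exact h1 z x s p (lt_of_leftmost hz (by order)) (by order) hsp (lt_of_least hp hc.ne) hx hsz
  by_cases hd : ∃ x, π x < π s ∧ x ≠ p
  · obtain ⟨x, hxs, hxp⟩ := hd
    by_cases hv : ∃ v, p < v ∧ π s < π v ∧ π v < π z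
    · obtain ⟨v, hpv, hsv, hvz⟩ := hv
      refine hsimple.not_interval (fun i => π i < π s) hxs hps hxp (lt_irrefl (π s))
        (fun a b j ha hb haj hjb => ?_) (fun a b j ha hb haj hjb => by order)
      by_contra! hc
      have h5 := hbelow a ha
      have h7 : p ≠ j := by rintro rfl; order
      have h8 : j ≠ b := by rintro rfl; order
      have h9 : π s ≠ π j := fun h => by have := inj _ _ h; order
      rcases lt_trichotomy (π j) (π z) with h | h | h
      · exact h1 z s j b hzs (by order) (by order) hb (by order) h
      · have := inj _ _ h; order
      · rcases lt_or_ge v b with h10 | h10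
        · exact h1 z s v b hzs (by order) h10 hb hsv hvz
        · have : b ≠ v := by rintro rfl; order
          exact h3 z s j b v hzs (by order) (by order) (by order) hb hsv hvz h
    · push Not at hv
      refine hsimple.not_interval (fun i => i < p) (by order : z < p) hsp hzs.ne
        (lt_irrefl p) (fun a b j ha hb haj hjb => by order) (fun a b j ha hb haj hjb => ?_)
      by_contra! hc
      have h5 := hU b hb
      have h6 : π s ≤ π a := by
        by_contra! hc
        have := hbelow a hc
        order
      have : p ≠ j := by rintro rfl; order
      have : π s ≠ π j := fun h => by have := inj _ _ h; order
      have h7 := hv j (by order) (by order)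
      have := inj j z (by order)
      order
  · push Not at hd
    refine hsimple.not_interval (fun i => i = s ∨ i = p) (Or.inl rfl) (Or.inr rfl) hsp.ne
      (z := z) (by rintro (rfl | rfl) <;> order) (fun a b j ha hb haj hjb => ?_)
      (fun a b j ha hb haj hjb => ?_)
    · have h5 : s ≤ j := by rcases ha with rfl | rfl <;> rcases hb with rfl | rfl <;> order
      have h6 : j ≤ p := by rcases ha with rfl | rfl <;> rcases hb with rfl | rfl <;> order
      by_contra! hc
      have h7 : j < p := lt_of_le_of_ne h6 hc.2
      have h8 : π j ≠ π z := fun h => by have := inj _ _ h; order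
      have h9 := hU j h7
      exact hc.1 (le_antisymm (hs j ⟨h7, by order⟩) h5)
    · have h5 : π j ≤ π s := by rcases ha with rfl | rfl <;> rcases hb with rfl | rfl <;> order
      by_cases h6 : π j = π s
      · exact Or.inl (inj _ _ h6)
      · exact Or.inr (hd j (by order))

/-- A simple permutation in `𝒜` cannot have both an entry larger than the leftmost and left of the
least, and an entry smaller than the leftmost and right of the least. -/
lemma not_upper_and_lower (hsimple : IsSimple π) (hA : InA π)
    (hz : ∀ j, z ≤ j) (hp : ∀ j, π p ≤ π j) {u d : Fin n}
    (hup : u < p) (hzu : π z < π u) (hpd : p < d) (hdz : π d < π z) : False := by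
  have inj : ∀ a b, π a = π b → a = b := fun a b h => π.injective h
  have h1 := fun a b c d => @Avoids.not_4231 n π hA.1 a b c d
  have h2 := fun a b c d e => @Avoids.not_35142 n π hA.2.1 a b c d e
  have h3 := fun a b c d e => @Avoids.not_42513 n π hA.2.2.1 a b c d e
  have h4 := fun a b c d e f => @Avoids.not_351624 n π hA.2.2.2 a b c d e f
  obtain ⟨t, ⟨htp, hzt⟩, ht⟩ :=
    exists_max_of_pred (fun x => x < p ∧ π z < π x) π ⟨u, hup, hzu⟩
  obtain ⟨q, ⟨hqp, hzq⟩, hq⟩ :=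
    exists_max_of_pred (fun x => x < p ∧ π z < π x) id ⟨u, hup, hzu⟩
  obtain ⟨e, ⟨hpe, hez⟩, he⟩ :=
    exists_max_of_pred (fun x => p < x ∧ π x < π z) id ⟨d, hpd, hdz⟩
  obtain ⟨m, ⟨hpm, hmz⟩, hm⟩ :=
    exists_max_of_pred (fun x => p < x ∧ π x < π z) π ⟨d, hpd, hdz⟩
  simp only [id] at hq he
  clear hup hzu hpd hdz u d
  have hzt' : z < t := lt_of_leftmost hz hzt.ne'
  have hzq' : z < q := lt_of_leftmost hz hzq.ne'
  by_cases hE : ∃ f, p < f ∧ π z < π f ∧ π f < π t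
  · obtain ⟨f, hpf, hzf, hft⟩ := hE
    have hef : e < f := by
      by_contra! hc
      have : f ≠ e := by rintro rfl; order
      exact h2 z t p f e hzt' htp hpf (by order) (lt_of_least hp hpe.ne') hez hzf hft
    have hno : ∀ g, p < g → g < e → π g < π z := by
      intro g hpg hge
      by_contra! hc
      have hgz : π z ≠ π g := fun h => by have := inj _ _ h; order
      rcases lt_trichotomy (π g) (π t) with h | h | h
      · exact h2 z t p g e hzt' htp hpg hge (lt_of_least hp hpe.ne') hez (by order) h
      · have := inj _ _ h; order
      · exact h4 z t p g e f hzt' htp hpg hge hef (lt_of_least hp hpe.ne') hez hzf hft h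
    refine hsimple.not_interval (fun i => π i ≤ π m) (x := p) (y := m) (hp m) le_rfl hpm.ne
      (z := z) (by simpa using hmz) (fun a b j ha hb haj hjb => ?_)
      (fun a b j ha hb haj hjb => by order)
    by_contra! hc
    have hbe : p < b → b ≤ e := fun h => he b ⟨h, by order⟩
    have haz : z < a := lt_of_leftmost hz (by order)
    have haj' : a ≠ j := by rintro rfl; order
    have hjz : π j ≠ π z := fun h => by have := inj _ _ h; order
    rcases lt_trichotomy j p with h | h | h
    · have hap : π p < π a := lt_of_least hp (by order)
      rcases lt_or_ge (π j) (π z) with h5 | h5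
      · exact h1 z a j p haz (by order) h hap (by order) h5
      · have ham : π a ≠ π m := fun h => by have := inj _ _ h; order
        exact h3 z a j p m haz (by order) h hpm hap (by order) hmz (by order)
    · subst h; have := hp m; order
    · have h5 := hbe (by order)
      have h6 : j ≠ b := by rintro rfl; order
      have h7 := hm j ⟨h, hno j h (by order)⟩
      order
  · push Not at hE
    refine hsimple.not_interval (fun i => i ≤ q) (x := z) (y := q) hzq'.le le_rfl hzq'.ne
      (z := p) (by simpa using hqp) (fun a b j ha hb haj hjb => by order)
      (fun a b j ha hb haj hjb => ?_)
    by_contra! hc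
    have hap : π p < π a := lt_of_least hp (by order)
    have hjz : π j ≠ π z := fun h => by have := inj _ _ h; order
    have haj' : π a ≠ π j := fun h => by have := inj _ _ h; order
    have hbj' : π b ≠ π j := fun h => by have := inj _ _ h; order
    rcases lt_trichotomy j p with h | h | h
    · rcases lt_or_ge (π j) (π z) with h5 | h5
      · exact h1 z a j p (lt_of_leftmost hz (by order)) (by order) h hap (by order) h5
      · have := hq j ⟨h, by order⟩
        order
    · subst h; order
    · rcases lt_or_ge (π j) (π z) with h5 | h5
      · have haq : a ≠ q := by rintro rfl; order
        exact h3 z a q p j (lt_of_leftmost hz (by order)) (by order) hqp h hap (by order) h5 hzq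
      · have h6 := ht b ⟨by order, by order⟩
        have h7 := hE j h (by order)
        order

end LeftmostAndLeast

theorem statement_9 {n : ℕ} (hn : 4 ≤ n) (π : Equiv.Perm (Fin n))
    (hsimple : IsSimple π) (hA : InA π) :
    Xor' (π ⟨0, by omega⟩ = ⟨1, by omega⟩) (π ⟨1, by omega⟩ = ⟨0, by omega⟩) := by
  have inj : ∀ a b, π a = π b → a = b := fun a b h => π.injective h
  obtain ⟨z, hz0⟩ : ∃ z : Fin n, z = ⟨0, by omega⟩ := ⟨_, rfl⟩
  obtain ⟨o, ho⟩ : ∃ o : Fin n, o = ⟨1, by omega⟩ := ⟨_, rfl⟩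
  obtain ⟨w, hw⟩ : ∃ w : Fin n, w = ⟨2, by omega⟩ := ⟨_, rfl⟩
  obtain ⟨p, hp0⟩ := π.surjective z
  obtain ⟨c, hc⟩ := π.surjective o
  rw [← hz0, ← ho]
  have hz : ∀ j, z ≤ j := fun j => by subst hz0; exact Nat.zero_le _
  have hp : ∀ j, π p ≤ π j := fun j => hp0 ▸ hz _
  have hzo : z ≠ o := by simp [hz0, ho]
  have hzw : z ≠ w := by simp [hz0, hw]
  have how : o ≠ w := by simp [ho, hw]
  have hlt_o : ∀ j, j < o → j = z := by
    intro j hj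
    subst hz0 ho
    ext
    simpa [Fin.lt_def] using hj
  have hzp : z ≠ p := by
    rintro rfl
    refine hsimple.not_interval (fun i => i ≠ z) hzo.symm hzw.symm how (z := z) (by simp)
      (fun a b j ha hb haj hjb => ?_) (fun a b j ha hb haj hjb => ?_)
    · rintro rfl
      exact ha (le_antisymm haj (hz a))
    · rintro rfl
      exact ha (inj _ _ (le_antisymm haj (hp a)))
  have hnot_both : ¬ (π z = o ∧ π o = z) := by
    rintro ⟨h1, h2⟩
    refine hsimple.not_interval (fun i => i ≤ o) (hz o) le_rfl hzo (z := w)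
      (by simp [ho, hw]) (fun a b j ha hb haj hjb => by order) (fun a b j ha hb haj hjb => ?_)
    have hb' : π b ≤ o := by
      rcases hb.lt_or_eq with h | h
      · rw [hlt_o b h, h1]
      · rw [h, h2]; exact hz o
    rcases (hjb.trans hb').lt_or_eq with h | h
    · have h3 := hlt_o _ h
      rw [← h2] at h3
      exact (inj _ _ h3).le
    · rw [← h1] at h
      rw [inj _ _ h]
      exact hz o
  have hone : π z = o ∨ π o = z := by
    by_contra! hne
    have hop : o < p := by
      by_contra! h
      rcases h.lt_or_eq with h | h
      · exact hzp (hlt_o p h).symm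
      · exact hne.2 (h ▸ hp0)
    have hcz : π c < π z := by
      by_contra! h
      rcases h.lt_or_eq with h | h
      · rw [hc] at h
        exact hzp (inj _ _ ((hlt_o _ h).trans hp0.symm))
      · exact hne.1 (h.trans hc)
    have hcp : c ≠ p := by rintro rfl; exact hzo (hp0.symm.trans hc)
    have hoz : π o ≠ π z := fun h => hzo (inj _ _ h).symm
    by_cases hD : ∃ d, p < d ∧ π d < π z
    · obtain ⟨d, hpd, hdz⟩ := hD
      by_cases hU : ∃ u, u < p ∧ π z < π u
      · obtain ⟨u, hup, hzu⟩ := hU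
        exact not_upper_and_lower hsimple hA hz hp hup hzu hpd hdz
      · push Not at hU
        exact not_corner_of_no_upper hsimple hA hz hp hU hop (lt_of_le_of_ne (hU o hop) hoz)
    · push Not at hD
      have hD' : ∀ j, p < j → π z < π j := fun j hj => lt_of_le_of_ne (hD j hj) fun h => by
        have := inj _ _ h
        have := hz p
        order
      have hcp' : c < p := by
        by_contra! h
        have := hD c (by order)
        order
      exact not_corner_of_no_lower hsimple hA hz hp hD' hcp' hcz
  rcases hone with h | h
  · exact Or.inl ⟨h, fun h' => hnot_both ⟨h, h'⟩⟩
  · exact Or.inr ⟨h, fun h' => hnot_both ⟨h', h⟩⟩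
end
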